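/- For every ε > 0 there exist infinitely differentiable functions φ₀, φ₁ : ℝ → ℝ taking values in the interval [0,1] such that: φ₀(x) = 0 and φ₁(x) = 1 for all x ≤ 0; φ₀(x) = 1 and φ₁(x) = 0 for all x ≥ 1; the derivatives satisfy |φᵢ'(x)| ≤ √2 + ε for all x ∈ ℝ and i ∈ {0,1}; and |φ₀(x)² + φ₁(x)² − 1| ≤ ε for all x ∈ ℝ. -/

import Mathlib

theorem minmax_aux (c x y : ℝ) (h0 : 0 ≤ c) (h1 : c ≤ 1) (h : x ≤ y) :
    (max 0 (min y c) - max 0 (min x c)) + (max c (min y 1) - max c (min x 1)) ≤ y - x := by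
  grind

open MeasureTheory Real in
theorem aux_g (u v : ℝ) (hu : 1/2 ≤ u) (huv : u ≤ v) (hv : v ≤ 1) :
    √(1-2*(1-u)^2) ≤ √(1-2*(1-v)^2) ∧
    √(1-2*(1-v)^2) ≤ √(1-2*(1-u)^2) + √2 * (v-u) := by
  have h2 : √2^2 = 2 := Real.sq_sqrt (by norm_num)
  have h20 : 0 ≤ √2 := Real.sqrt_nonneg 2
  constructor
  · apply Real.sqrt_le_sqrt; nlinarith
  · have hp : 0 ≤ 1-2*(1-u)^2 := by nlinarith
    have hg := Real.sq_sqrt hp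
    have hg0 := Real.sqrt_nonneg (1-2*(1-u)^2)
    have hk : 1 ≤ √2 * √(1-2*(1-u)^2) := by
      rw [← Real.sqrt_mul (by norm_num)]
      apply Real.one_le_sqrt.2; nlinarith
    set g := √(1-2*(1-u)^2)
    apply Real.sqrt_le_iff.2
    constructor
    · have := mul_nonneg h20 (sub_nonneg.2 huv); linarith
    · have e : (g + √2 * (v-u))^2 = g^2 + 2*(√2*g)*(v-u) + √2^2*(v-u)^2 := by ring
      rw [e, h2, hg]
      nlinarith [mul_nonneg (sub_nonneg.2 hk) (sub_nonneg.2 huv)]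

noncomputable def auxF (x : ℝ) : ℝ :=
  √2 * max 0 (min x (1/2)) + √(1-2*(1 - max (1/2) (min x 1))^2) - √2/2

theorem sqrt_half : √(1-2*(1-(1/2:ℝ))^2) = √2/2 := by
  have h2 : √2^2 = 2 := Real.sq_sqrt (by norm_num)
  have h20 : 0 ≤ √2 := Real.sqrt_nonneg 2
  rw [Real.sqrt_eq_iff_mul_self_eq (by norm_num) (by positivity)]
  nlinarith

theorem auxF_mono (x y : ℝ) (h : x ≤ y) : auxF x ≤ auxF y ∧ auxF y ≤ auxF x + √2 * (y - x) := by
  have h20 : 0 ≤ √2 := Real.sqrt_nonneg 2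
  have hM : max (1/2) (min x 1) ≤ max (1/2) (min y 1) := by gcongr
  have hm : max 0 (min x (1/2)) ≤ max 0 (min y (1/2)) := by gcongr
  obtain ⟨a, b⟩ := aux_g _ _ (le_max_left (1/2) (min x 1)) hM (by simp; norm_num)
  have hs : (max 0 (min y (1/2)) - max 0 (min x (1/2))) +
      (max (1/2) (min y 1) - max (1/2) (min x 1)) ≤ y - x :=
    minmax_aux _ _ _ (by norm_num) (by norm_num) h
  have := mul_le_mul_of_nonneg_left hs h20
  have h3 := mul_le_mul_of_nonneg_left hm h20
  unfold auxF
  constructor <;> linarith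

theorem auxF_low (x : ℝ) (h : x ≤ 1/2) : auxF x = √2 * max 0 x := by
  have : max (1/2) (min x 1) = 1/2 := by grind
  have h' : min x (1/2) = x := by grind
  rw [auxF, this, sqrt_half, h']; ring

theorem auxF_high (x : ℝ) (h : 1/2 ≤ x) : auxF x = √(1-2*(1-min x 1)^2) := by
  have : max (1/2) (min x 1) = min x 1 := by grind
  have h' : max 0 (min x (1/2)) = 1/2 := by
    rw [min_eq_right h]; norm_num
  rw [auxF, this, h']; ring

theorem auxF_zero (x : ℝ) (h : x ≤ 0) : auxF x = 0 := by
  rw [auxF_low x (by linarith), max_eq_left h, mul_zero]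

theorem auxF_one (x : ℝ) (h : 1 ≤ x) : auxF x = 1 := by
  rw [auxF_high x (by linarith), min_eq_right h]; norm_num

theorem auxF_mem (x : ℝ) : 0 ≤ auxF x ∧ auxF x ≤ 1 := by
  constructor
  · rcases le_total x 0 with h | h
    · rw [auxF_zero x h]
    · rw [← auxF_zero 0 le_rfl]; exact (auxF_mono _ _ h).1
  · rcases le_total x 1 with h | h
    · rw [← auxF_one 1 le_rfl]; exact (auxF_mono _ _ h).1
    · rw [auxF_one x h]

theorem auxF_sq' (x : ℝ) (h : x ≤ 1/2) : auxF x ^ 2 + auxF (1-x) ^ 2 = 1 := by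
  have h2 : √2^2 = 2 := Real.sq_sqrt (by norm_num)
  have e : 1 - min (1-x) 1 = max 0 x := by grind
  have hb : max 0 x ≤ 1/2 := by grind
  have hc : 0 ≤ max 0 x := le_max_left _ _
  rw [auxF_low x h, auxF_high (1-x) (by linarith), e, Real.sq_sqrt (by nlinarith), mul_pow, h2]
  ring

theorem auxF_sq (x : ℝ) : auxF x ^ 2 + auxF (1-x) ^ 2 = 1 := by
  rcases le_total x (1/2) with h | h
  · exact auxF_sq' x h
  · have := auxF_sq' (1-x) (by linarith)
    rw [sub_sub_cancel] at this; linarith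

theorem auxF_lip (x y : ℝ) : |auxF x - auxF y| ≤ √2 * |x - y| := by
  rcases le_total x y with h | h
  · obtain ⟨a, b⟩ := auxF_mono x y h
    rw [abs_of_nonpos (by linarith), abs_of_nonpos (by linarith)]; linarith
  · obtain ⟨a, b⟩ := auxF_mono y x h
    rw [abs_of_nonneg (by linarith), abs_of_nonneg (by linarith)]; linarith

theorem auxF_cont : Continuous auxF := by
  unfold auxF; fun_prop

open MeasureTheory Convolution in
theorem moll (δ : ℝ) (hδ : 0 < δ) : ∃ F : ℝ → ℝ, ContDiff ℝ (⊤ : ℕ∞) F ∧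
    (∀ x, 0 ≤ F x ∧ F x ≤ 1) ∧ (∀ x ≤ -δ, F x = 0) ∧ (∀ x ≥ 1 + δ, F x = 1) ∧
    (∀ x y, |F x - F y| ≤ √2 * |x - y|) ∧ (∀ x, |F x - auxF x| ≤ √2 * δ) := by
  let φ : ContDiffBump (0:ℝ) := ⟨δ/2, δ, by linarith, by linarith⟩
  have hint : ∀ x, Integrable (fun t => φ.normed volume t * auxF (x - t)) := fun x =>
    (φ.continuous_normed.mul (auxF_cont.comp (by fun_prop))).integrable_of_hasCompactSupport
      φ.hasCompactSupport_normed.mul_right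
  have hF : ∀ x, (φ.normed volume ⋆[ContinuousLinearMap.lsmul ℝ ℝ, volume] auxF) x
      = ∫ t, φ.normed volume t * auxF (x - t) := fun x => rfl
  have hn := φ.nonneg_normed (μ := volume)
  have hi := φ.integrable_normed (μ := volume)
  refine ⟨(φ.normed volume ⋆[ContinuousLinearMap.lsmul ℝ ℝ, volume] auxF), ?_, ?_, ?_, ?_, ?_, ?_⟩
  · exact φ.hasCompactSupport_normed.contDiff_convolution_left _ φ.contDiff_normed
      auxF_cont.locallyIntegrable
  · intro x
    rw [hF]
    refine ⟨integral_nonneg fun t => mul_nonneg (hn t) (auxF_mem _).1, ?_⟩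
    rw [← φ.integral_normed (μ := volume)]
    exact integral_mono (hint x) hi fun t => mul_le_of_le_one_right (hn t) (auxF_mem _).2
  · intro x hx
    rw [φ.normed_convolution_eq_right, auxF_zero x (by linarith)]
    intro y hy
    rw [Metric.mem_ball, Real.dist_eq, abs_lt] at hy
    have : φ.rOut = δ := rfl
    rw [auxF_zero x (by linarith), auxF_zero y (by linarith)]
  · intro x hx
    rw [φ.normed_convolution_eq_right, auxF_one x (by linarith)]
    intro y hy
    rw [Metric.mem_ball, Real.dist_eq, abs_lt] at hy
    have : φ.rOut = δ := rfl
    rw [auxF_one x (by linarith), auxF_one y (by linarith)]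
  · intro x y
    rw [hF, hF, ← integral_sub (hint x) (hint y)]
    have h1 : ∫ t, φ.normed volume t * (√2 * |x - y|) = √2 * |x - y| := by
      rw [integral_mul_const, φ.integral_normed, one_mul]
    rw [← h1, ← Real.norm_eq_abs]
    refine norm_integral_le_of_norm_le (hi.mul_const _) (Filter.Eventually.of_forall fun t => ?_)
    rw [← mul_sub, Real.norm_eq_abs, abs_mul, abs_of_nonneg (hn t)]
    have := auxF_lip (x - t) (y - t)
    rw [sub_sub_sub_cancel_right] at this
    exact mul_le_mul_of_nonneg_left this (hn t)
  · intro x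
    rw [← Real.dist_eq]
    refine φ.dist_normed_convolution_le auxF_cont.aestronglyMeasurable fun y hy => ?_
    rw [Metric.mem_ball, Real.dist_eq] at hy
    rw [Real.dist_eq]
    exact (auxF_lip y x).trans (mul_le_mul_of_nonneg_left hy.le (Real.sqrt_nonneg 2))

theorem deriv_bd (f : ℝ → ℝ) (C : ℝ) (hC : 0 ≤ C) (h : ∀ x y, |f x - f y| ≤ C * |x - y|) (x : ℝ) :
    |deriv f x| ≤ C := by
  have hl : LipschitzWith ⟨C, hC⟩ f := LipschitzWith.of_dist_le_mul fun a b => by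
    rw [Real.dist_eq, Real.dist_eq]; exact h a b
  exact norm_deriv_le_of_lipschitz hl

/-- For every `ε > 0` there exist smooth functions `φ₀ φ₁ : ℝ → [0,1]` with
`φ₀ = 0`, `φ₁ = 1` on `(-∞, 0]`, `φ₀ = 1`, `φ₁ = 0` on `[1, ∞)`,
`|φᵢ'| ≤ √2 + ε` and `|φ₀² + φ₁² − 1| ≤ ε`. -/
theorem interpolating_functions (ε : ℝ) (hε : 0 < ε) :
    ∃ φ₀ φ₁ : ℝ → ℝ,
      ContDiff ℝ (⊤ : ℕ∞) φ₀ ∧ ContDiff ℝ (⊤ : ℕ∞) φ₁ ∧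
      (∀ x, φ₀ x ∈ Set.Icc (0:ℝ) 1) ∧ (∀ x, φ₁ x ∈ Set.Icc (0:ℝ) 1) ∧
      (∀ x ≤ (0:ℝ), φ₀ x = 0 ∧ φ₁ x = 1) ∧
      (∀ x ≥ (1:ℝ), φ₀ x = 1 ∧ φ₁ x = 0) ∧
      (∀ x, |deriv φ₀ x| ≤ Real.sqrt 2 + ε) ∧
      (∀ x, |deriv φ₁ x| ≤ Real.sqrt 2 + ε) ∧
      (∀ x, |φ₀ x ^ 2 + φ₁ x ^ 2 - 1| ≤ ε) := by
  obtain ⟨F, hs, hm, h0, h1, hl, hd⟩ := moll (ε/6) (by positivity)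
  have h20 : 0 ≤ √2 := Real.sqrt_nonneg 2
  have h2 : √2 ≤ 3/2 := by rw [Real.sqrt_le_iff]; norm_num
  have ha : 0 ≤ 1 + 2*(ε/6) := by positivity
  have hC : √2 * (1 + 2*(ε/6)) ≤ √2 + ε := by nlinarith
  refine ⟨fun x => F ((1+2*(ε/6))*x - ε/6), fun x => F (1 - ((1+2*(ε/6))*x - ε/6)),
    hs.comp (by fun_prop), hs.comp (by fun_prop), fun x => hm _, fun x => hm _, ?_, ?_, ?_, ?_, ?_⟩
  · intro x hx
    have := mul_nonpos_of_nonneg_of_nonpos ha hx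
    exact ⟨h0 _ (by linarith), h1 _ (by linarith)⟩
  · intro x hx
    have := mul_le_mul_of_nonneg_left hx.le ha
    exact ⟨h1 _ (by linarith), h0 _ (by linarith)⟩
  · intro x
    refine (deriv_bd _ _ (mul_nonneg h20 ha) (fun x y => ?_) x).trans hC
    refine (hl _ _).trans (le_of_eq ?_)
    rw [mul_assoc, ← abs_of_nonneg ha, ← abs_mul, abs_of_nonneg ha]
    congr 2; ring
  · intro x
    refine (deriv_bd _ _ (mul_nonneg h20 ha) (fun x y => ?_) x).trans hC
    refine (hl _ _).trans (le_of_eq ?_)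
    rw [mul_assoc, ← abs_of_nonneg ha, ← abs_mul, abs_of_nonneg ha, abs_sub_comm]
    congr 2; ring
  · intro x
    have key : ∀ y, |F y ^ 2 - auxF y ^ 2| ≤ ε/2 := by
      intro y
      rw [sq_sub_sq, abs_mul]
      have a1 := hm y
      have a2 := auxF_mem y
      have a3 : |F y + auxF y| ≤ 2 := by rw [abs_le]; constructor <;> linarith
      calc _ ≤ 2 * (√2 * (ε/6)) := mul_le_mul a3 (hd y) (abs_nonneg _) (by norm_num)
        _ ≤ ε/2 := by nlinarith
    have k1 := abs_le.1 (key ((1+2*(ε/6))*x - ε/6))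
    have k2 := abs_le.1 (key (1 - ((1+2*(ε/6))*x - ε/6)))
    have k3 := auxF_sq ((1+2*(ε/6))*x - ε/6)
    rw [abs_le]
    constructor <;> dsimp only <;> linarith
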